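/- Let β be the arcsine law on [−2,2] and ω the measure on [−2,2]² with density (4 − xy)/(4π²√((4−x²)(4−y²))) with respect to Lebesgue measure. Then for every C¹ function f on [−2,2], (1/2)·Var_β(f) ≤ ∬ ((f(x) − f(y))/(x − y))² ω(dx dy), where Var_β(f) = ∫ f² dβ − (∫ f dβ)². Moreover, equality in the Fourier–Chebyshev expansion sense corresponds to the fact that if f = ∑_{n≥1} a_n φ_n in L²(β) then the left side equals (1/2)∑ a_n² · 2 · (1/2) and the right side equals (1/2)∑ n a_n². -/

import Mathlib

open MeasureTheory Real

/-- The arcsine law on `[-2,2]`. -/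
noncomputable def arcsineLaw : Measure ℝ :=
  (volume.restrict (Set.Icc (-2 : ℝ) 2)).withDensity
    fun y => ENNReal.ofReal (1 / (π * Real.sqrt (4 - y ^ 2)))

/-- The measure `ω` on `[-2,2]²` with density
`(4 - xy)/(4π² √((4-x²)(4-y²)))` w.r.t. Lebesgue measure. -/
noncomputable def omegaMeasure : Measure (ℝ × ℝ) :=
  (volume.restrict ((Set.Icc (-2 : ℝ) 2) ×ˢ (Set.Icc (-2 : ℝ) 2))).withDensity
    fun p => ENNReal.ofReal
      ((4 - p.1 * p.2) / (4 * π ^ 2 * Real.sqrt ((4 - p.1 ^ 2) * (4 - p.2 ^ 2))))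

open AddCircle

section AddCircle

variable {T : ℝ} [hT : Fact (0 < T)]

lemma integrable_haarAddCircle {E : Type*} [NormedAddCommGroup E] {f : AddCircle T → E}
    (hf : Continuous f) : Integrable f haarAddCircle :=
  hf.integrable_of_hasCompactSupport (HasCompactSupport.of_compactSpace _)

lemma fourierCoeff_comp_add_left (G : AddCircle T → ℂ) (t : AddCircle T) (n : ℤ) :
    fourierCoeff (fun b => G (t + b)) n = fourier n t * fourierCoeff G n := by
  unfold fourierCoeff
  rw [← integral_add_left_eq_self (fun b => fourier (-n) b • G b) t, ← integral_const_mul]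
  refine integral_congr_ae (Filter.Eventually.of_forall fun b => ?_)
  have h : fourier n t * fourier (-n) t = 1 := by
    rw [← fourier_add, add_neg_cancel, fourier_zero]
  have h' : fourier (-n) (t + b) = fourier (-n) t * fourier (-n) b := by
    simp [fourier_apply, smul_add, toCircle_add]
  simp only [smul_eq_mul, h']
  linear_combination (-(fourier (-n) b * G (t + b))) * h

lemma hasSum_sq_fourierCoeff_continuousMap (G : C(AddCircle T, ℂ)) :
    HasSum (fun n => ‖fourierCoeff G n‖ ^ 2) (∫ t, ‖G t‖ ^ 2 ∂haarAddCircle) := by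
  have h := hasSum_sq_fourierCoeff (ContinuousMap.toLp (E := ℂ) 2 haarAddCircle ℂ G)
  simp_rw [fourierCoeff_toLp] at h
  convert h using 1
  refine integral_congr_ae ?_
  filter_upwards [ContinuousMap.coeFn_toLp (p := 2) (𝕜 := ℂ) haarAddCircle G] with t ht
  rw [ht]

lemma hasSum_sq_fourierCoeff_translate_sub (G : C(AddCircle T, ℂ)) (t : AddCircle T) :
    HasSum (fun n => ‖fourier n t - 1‖ ^ 2 * ‖fourierCoeff G n‖ ^ 2)
      (∫ b, ‖G (t + b) - G b‖ ^ 2 ∂haarAddCircle) := by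
  have h := hasSum_sq_fourierCoeff_continuousMap
    (⟨fun b => G (t + b) + (-1 : ℂ) * G b, by fun_prop⟩ : C(AddCircle T, ℂ))
  have key : ∀ n, fourierCoeff (fun b => G (t + b) + (-1 : ℂ) * G b) n
      = (fourier n t - 1) * fourierCoeff G n := fun n => by
    have := fourierCoeff.add (integrable_haarAddCircle (f := fun b => G (t + b)) (by fun_prop))
      (integrable_haarAddCircle (f := fun b => (-1 : ℂ) * G b) (by fun_prop))
    have := congrFun this n
    simp only [Pi.add_def] at this
    rw [this, fourierCoeff_comp_add_left, fourierCoeff.const_mul]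
    ring
  simp only [ContinuousMap.coe_mk, key, norm_mul, mul_pow] at h
  simpa only [neg_one_mul, ← sub_eq_add_neg] using h

lemma fourier_one_ne_one {t : AddCircle T} (ht : t ≠ 0) : fourier 1 t ≠ (1 : ℂ) := by
  intro h
  rw [fourier_one, Circle.coe_eq_one] at h
  exact ht (injective_toCircle hT.out.ne' (h.trans toCircle_zero.symm))

lemma integral_fourier (n : ℤ) :
    ∫ t : AddCircle T, fourier n t ∂haarAddCircle = if n = 0 then 1 else 0 := by
  have h := congrFun (fourierCoeff_fourier (T := T) n) 0
  simp only [fourierCoeff, neg_zero, fourier_zero, one_smul] at h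
  rw [h]
  simp [Pi.single_apply, eq_comm]

lemma one_le_lintegral_fourier_natCast_ratio {n : ℕ} (hn : n ≠ 0) :
    1 ≤ ∫⁻ t : AddCircle T,
      ENNReal.ofReal (‖fourier n t - 1‖ ^ 2 / ‖fourier 1 t - 1‖ ^ 2) ∂haarAddCircle := by
  set p : AddCircle T → ℂ := fun t => ∑ j ∈ Finset.range n, fourier j t with hp
  have hpc : Continuous p := by fun_prop
  have hp1 : ∫ t, p t ∂haarAddCircle = 1 := by
    rw [hp, integral_finsetSum _ fun j _ => integrable_haarAddCircle (by fun_prop)]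
    simp_rw [integral_fourier]
    simp [Nat.pos_of_ne_zero hn]
  have hae : ∀ᵐ t : AddCircle T ∂haarAddCircle,
      ‖fourier n t - 1‖ ^ 2 / ‖fourier 1 t - 1‖ ^ 2 = ‖p t‖ ^ 2 := by
    have h0 : ∀ᵐ t : AddCircle T ∂haarAddCircle, t ≠ 0 := by
      have hv : ∀ᵐ t : AddCircle T, t ≠ 0 := by
        have h := volume_closedBall T (x := 0) 0
        simpa [ae_iff, hT.out.le] using h
      rw [volume_eq_smul_haarAddCircle] at hv
      exact (Measure.ae_ennreal_smul_measure_iff (by simpa using hT.out)).1 hv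
    filter_upwards [h0] with t ht
    have hne := sub_ne_zero.2 (fourier_one_ne_one ht)
    have hpow : ∀ j : ℕ, fourier (j : ℤ) t = (fourier 1 t : ℂ) ^ j := fun j => by
      simp [fourier_apply, toCircle_nsmul]
    have hg : fourier n t - 1 = p t * (fourier 1 t - 1) := by
      simp_rw [hp, hpow]
      rw [geom_sum_mul]
    rw [hg, norm_mul, mul_pow, mul_div_cancel_right₀]
    positivity
  rw [lintegral_congr_ae (hae.mono fun t ht => congrArg ENNReal.ofReal ht),
    ← ofReal_integral_eq_lintegral_ofReal (integrable_haarAddCircle (by fun_prop))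
      (Filter.Eventually.of_forall fun t => by positivity), ENNReal.one_le_ofReal]
  have hre : ∫ t, (p t).re ∂haarAddCircle = 1 := by
    have := integral_re (integrable_haarAddCircle hpc)
    simpa [hp1] using this
  calc (1 : ℝ) = ∫ t, (2 * (p t).re - 1) ∂haarAddCircle := by
        rw [integral_sub (integrable_haarAddCircle (by fun_prop))
          (integrable_haarAddCircle (by fun_prop)), integral_const_mul, hre]
        simp; norm_num
    _ ≤ _ := integral_mono (integrable_haarAddCircle (by fun_prop))
        (integrable_haarAddCircle (by fun_prop)) fun t => by
        have := Complex.normSq_apply (p t)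
        rw [Complex.normSq_eq_norm_sq] at this
        simp only [this]
        nlinarith [sq_nonneg ((p t).re - 1), sq_nonneg (p t).im]

lemma one_le_lintegral_fourier_ratio {n : ℤ} (hn : n ≠ 0) :
    1 ≤ ∫⁻ t : AddCircle T,
      ENNReal.ofReal (‖fourier n t - 1‖ ^ 2 / ‖fourier 1 t - 1‖ ^ 2) ∂haarAddCircle := by
  obtain ⟨m, rfl | rfl⟩ := n.eq_nat_or_neg
  · exact one_le_lintegral_fourier_natCast_ratio (by simpa using hn)
  · refine (one_le_lintegral_fourier_natCast_ratio (T := T) (n := m) (by simpa using hn)).trans_eq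
      (lintegral_congr fun t => ?_)
    have : fourier (-(m : ℤ)) t - 1 = (starRingEnd ℂ) (fourier m t - 1) := by
      rw [fourier_neg, map_sub, map_one]
    rw [this, RCLike.norm_conj]

/-- The circle version of the spectral gap inequality. -/
lemma ofReal_variance_le_lintegral_translate_sub (G : C(AddCircle T, ℂ)) :
    ENNReal.ofReal ((∫ t, ‖G t‖ ^ 2 ∂haarAddCircle) - ‖∫ t, G t ∂haarAddCircle‖ ^ 2) ≤
      ∫⁻ t, ∫⁻ b, ENNReal.ofReal (‖G (t + b) - G b‖ ^ 2 / ‖fourier 1 t - 1‖ ^ 2)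
        ∂haarAddCircle ∂haarAddCircle := by
  have hinner : ∀ t : AddCircle T,
      ∫⁻ b, ENNReal.ofReal (‖G (t + b) - G b‖ ^ 2 / ‖fourier 1 t - 1‖ ^ 2) ∂haarAddCircle =
      ∑' n, ENNReal.ofReal (‖fourier n t - 1‖ ^ 2 / ‖fourier 1 t - 1‖ ^ 2) *
        ENNReal.ofReal (‖fourierCoeff G n‖ ^ 2) := fun t => by
    have h := (hasSum_sq_fourierCoeff_translate_sub G t).div_const (‖fourier 1 t - 1‖ ^ 2)
    rw [← ofReal_integral_eq_lintegral_ofReal (integrable_haarAddCircle (by fun_prop))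
      (Filter.Eventually.of_forall fun t => by positivity), integral_div, ← h.tsum_eq,
      ENNReal.ofReal_tsum_of_nonneg (fun n => by positivity) h.summable]
    refine tsum_congr fun n => ?_
    rw [← ENNReal.ofReal_mul (by positivity)]
    congr 1; ring
  have hm : ∀ n : ℤ, Measurable fun t : AddCircle T =>
      ENNReal.ofReal (‖fourier n t - 1‖ ^ 2 / ‖fourier 1 t - 1‖ ^ 2) := fun n => by
    refine ENNReal.measurable_ofReal.comp (Measurable.div ?_ ?_) <;>
      exact Continuous.measurable (by fun_prop)
  simp_rw [hinner]
  rw [lintegral_tsum fun n => ((hm n).mul_const _).aemeasurable]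
  simp_rw [lintegral_mul_const _ (hm _)]
  have hP := hasSum_sq_fourierCoeff_continuousMap G
  have h0 : fourierCoeff G 0 = ∫ t, G t ∂haarAddCircle := by simp [fourierCoeff]
  have hsplit := hP.update 0 (0 : ℝ)
  rw [h0, show (0 : ℝ) - ‖∫ t, G t ∂haarAddCircle‖ ^ 2 + ∫ t, ‖G t‖ ^ 2 ∂haarAddCircle =
    (∫ t, ‖G t‖ ^ 2 ∂haarAddCircle) - ‖∫ t, G t ∂haarAddCircle‖ ^ 2 by ring] at hsplit
  rw [← hsplit.tsum_eq, ENNReal.ofReal_tsum_of_nonneg (fun n => ?_) hsplit.summable]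
  · refine ENNReal.tsum_le_tsum fun n => ?_
    rcases eq_or_ne n 0 with rfl | hn
    · simp
    · rw [Function.update_of_ne hn]
      exact le_mul_of_one_le_left zero_le (one_le_lintegral_fourier_ratio hn)
  · rcases eq_or_ne n 0 with rfl | hn
    · simp
    · rw [Function.update_of_ne hn]; positivity

end AddCircle

lemma omegaMeasure_eq_withDensity_prod :
    omegaMeasure = (arcsineLaw.prod arcsineLaw).withDensity
      fun p => ENNReal.ofReal ((4 - p.1 * p.2) / 4) := by
  have hm : Measurable fun y : ℝ => ENNReal.ofReal (1 / (π * √(4 - y ^ 2))) := by fun_prop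
  rw [arcsineLaw, prod_withDensity hm hm, Measure.prod_restrict, ← Measure.volume_eq_prod,
    ← withDensity_mul _ (by fun_prop) (by fun_prop), omegaMeasure]
  refine withDensity_congr_ae (ae_restrict_of_forall_mem
    (measurableSet_Icc.prod measurableSet_Icc) fun p hp => ?_)
  obtain ⟨⟨h1, h2⟩, -, -⟩ := hp
  have h : 0 ≤ 4 - p.1 ^ 2 := by nlinarith
  simp only [Pi.mul_apply]
  rw [← ENNReal.ofReal_mul (by positivity), ← ENNReal.ofReal_mul (by positivity),
    Real.sqrt_mul h]
  congr 1
  simp only [div_eq_mul_inv, mul_inv]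
  ring

lemma lintegral_arcsineLaw (h : ℝ → ENNReal) (hh : Measurable h) :
    ∫⁻ x, h x ∂arcsineLaw = ENNReal.ofReal π⁻¹ * ∫⁻ θ in Set.Ioo 0 π, h (2 * cos θ) := by
  have himg : (fun θ => 2 * cos θ) '' Set.Ioo 0 π = Set.Ioo (-2) 2 := by
    ext x
    simp only [Set.mem_image, Set.mem_Ioo]
    constructor
    · rintro ⟨θ, ⟨h0, h1⟩, rfl⟩
      have a := cos_lt_cos_of_nonneg_of_le_pi le_rfl h1.le h0
      have b := cos_lt_cos_of_nonneg_of_le_pi h0.le le_rfl h1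
      simp only [cos_zero, cos_pi] at a b
      constructor <;> linarith
    · rintro ⟨h0, h1⟩
      refine ⟨arccos (x / 2), ⟨arccos_pos.2 (by linarith), ?_⟩, ?_⟩
      · refine lt_of_le_of_ne (arccos_le_pi _) fun hc => ?_
        rw [arccos_eq_pi] at hc
        linarith
      · rw [cos_arccos (by linarith) (by linarith)]; ring
  have hinj : Set.InjOn (fun θ => 2 * cos θ) (Set.Ioo 0 π) := fun a ha b hb hab =>
    injOn_cos (Set.Ioo_subset_Icc_self ha) (Set.Ioo_subset_Icc_self hb) (by simpa using hab)
  rw [arcsineLaw, lintegral_withDensity_eq_lintegral_mul _ (by fun_prop) hh,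
    setLIntegral_congr Ioo_ae_eq_Icc.symm, ← himg,
    lintegral_image_eq_lintegral_abs_deriv_mul measurableSet_Ioo
      (fun θ _ => ((hasDerivAt_cos θ).const_mul 2).hasDerivWithinAt) hinj,
    ← lintegral_const_mul _ (by fun_prop)]
  refine setLIntegral_congr_fun measurableSet_Ioo fun θ hθ => ?_
  have hs := sin_pos_of_mem_Ioo hθ
  have hsq : √(4 - (2 * cos θ) ^ 2) = 2 * sin θ := by
    rw [show 4 - (2 * cos θ) ^ 2 = (2 * sin θ) ^ 2 by linarith [sin_sq_add_cos_sq θ]]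
    exact sqrt_sq (by positivity)
  simp only [Pi.mul_apply, hsq]
  rw [← mul_assoc, ← ENNReal.ofReal_mul (abs_nonneg _)]
  congr 2
  rw [abs_mul, abs_neg, abs_of_pos hs, abs_two]
  field_simp

local instance : Fact (0 < 2 * π) := ⟨two_pi_pos⟩

/-- The function `2 cos` on the circle `ℝ / 2πℤ`. -/
noncomputable def twoCos (t : AddCircle (2 * π)) : ℝ := 2 * (fourier 1 t : ℂ).re

lemma continuous_twoCos : Continuous twoCos := by unfold twoCos; fun_prop

lemma twoCos_coe (θ : ℝ) : twoCos θ = 2 * cos θ := by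
  have h : (2 * π * Complex.I * θ / (2 * π : ℝ) : ℂ) = θ * Complex.I := by
    have : (π : ℂ) ≠ 0 := by exact_mod_cast pi_ne_zero
    push_cast
    field_simp
  rw [twoCos, fourier_coe_apply, Int.cast_one, mul_one, h, Complex.exp_ofReal_mul_I_re]

lemma arcsineLaw_eq_map : arcsineLaw = Measure.map twoCos haarAddCircle := by
  refine Measure.ext_of_lintegral _ fun h hh => ?_
  have hc : Measurable fun θ : ℝ => h (2 * cos θ) := by fun_prop
  rw [lintegral_map hh continuous_twoCos.measurable, lintegral_arcsineLaw h hh]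
  have hv := AddCircle.lintegral_preimage (2 * π) (-π) (fun t => h (twoCos t))
  rw [volume_eq_smul_haarAddCircle, lintegral_smul_measure] at hv
  simp_rw [twoCos_coe] at hv
  have hIoc : Set.Ioc (-π) (-π + 2 * π) = Set.Ioc (-π) 0 ∪ Set.Ioc 0 π := by
    rw [Set.Ioc_union_Ioc_eq_Ioc (by linarith [pi_pos]) pi_pos.le]; congr 1; ring
  have hneg : ∫⁻ θ in Set.Ioc (-π) 0, h (2 * cos θ) = ∫⁻ θ in Set.Ioo 0 π, h (2 * cos θ) := by
    have := (Measure.measurePreserving_neg (volume : Measure ℝ)).setLIntegral_comp_preimage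
      (measurableSet_Ioo (a := 0) (b := π)) hc
    rw [← this, setLIntegral_congr Ioo_ae_eq_Ioc.symm]
    simp
  rw [hIoc, lintegral_union measurableSet_Ioc (Set.Ioc_disjoint_Ioc_of_le le_rfl), hneg,
    setLIntegral_congr Ioo_ae_eq_Ioc.symm, ← two_mul, ENNReal.ofReal_mul zero_le_two,
    smul_eq_mul, ENNReal.ofReal_ofNat, mul_assoc,
    ENNReal.mul_right_inj two_ne_zero ENNReal.ofNat_ne_top] at hv
  rw [hv, ← mul_assoc, ← ENNReal.ofReal_mul (by positivity), inv_mul_cancel₀ pi_ne_zero]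
  simp

lemma twoCos_neg (t : AddCircle (2 * π)) : twoCos (-t) = twoCos t := by
  have : fourier 1 (-t) = (starRingEnd ℂ) (fourier 1 t) := by
    rw [← fourier_neg]; simp [fourier_apply]
  rw [twoCos, this, Complex.conj_re, twoCos]

lemma abs_twoCos_le (t : AddCircle (2 * π)) : |twoCos t| ≤ 2 := by
  have h := Complex.abs_re_le_norm (fourier 1 t)
  rw [fourier_one, Circle.norm_coe] at h
  rw [twoCos, abs_mul, abs_two, fourier_one]
  linarith

/-- In the angular variables the kernel `(4 - xy) / (x - y)²` splits into two chordal kernels. -/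
lemma four_sub_mul_div_sq_mul {z w : ℂ} (hz : ‖z‖ = 1) (hw : ‖w‖ = 1) (f : ℝ → ℝ) :
    (4 - 2 * z.re * (2 * w.re)) / 4 *
        ((f (2 * z.re) - f (2 * w.re)) / (2 * z.re - 2 * w.re)) ^ 2 =
      1 / 4 * ((f (2 * z.re) - f (2 * w.re)) ^ 2 / ‖z - w‖ ^ 2) +
      1 / 4 * ((f (2 * z.re) - f (2 * w.re)) ^ 2 / ‖z - (starRingEnd ℂ) w‖ ^ 2) := by
  rcases eq_or_ne z.re w.re with h | h
  · simp [h]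
  have hz' : z.re * z.re + z.im * z.im = 1 := by
    rw [← Complex.normSq_apply, Complex.normSq_eq_norm_sq, hz, one_pow]
  have hw' : w.re * w.re + w.im * w.im = 1 := by
    rw [← Complex.normSq_apply, Complex.normSq_eq_norm_sq, hw, one_pow]
  have h1 : ‖z - w‖ ^ 2 = 2 - 2 * (z.re * w.re) - 2 * (z.im * w.im) := by
    rw [← Complex.normSq_eq_norm_sq, Complex.normSq_apply, Complex.sub_re, Complex.sub_im]
    linear_combination hz' + hw'
  have h2 : ‖z - (starRingEnd ℂ) w‖ ^ 2 = 2 - 2 * (z.re * w.re) + 2 * (z.im * w.im) := by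
    rw [← Complex.normSq_eq_norm_sq, Complex.normSq_apply, Complex.sub_re, Complex.sub_im,
      Complex.conj_re, Complex.conj_im]
    linear_combination hz' + hw'
  have hprod : (2 * z.re - 2 * w.re) ^ 2 = ‖z - w‖ ^ 2 * ‖z - (starRingEnd ℂ) w‖ ^ 2 := by
    rw [h1, h2]
    linear_combination (4 * w.im ^ 2) * hz' + (4 - 4 * z.re ^ 2) * hw'
  have hsum : 4 - 2 * z.re * (2 * w.re) = ‖z - w‖ ^ 2 + ‖z - (starRingEnd ℂ) w‖ ^ 2 := by
    rw [h1, h2]; ring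
  have hpos : (2 * z.re - 2 * w.re) ^ 2 ≠ 0 := pow_ne_zero _ fun h0 => h (by linarith)
  rw [hprod] at hpos
  have hA := left_ne_zero_of_mul hpos
  have hB := right_ne_zero_of_mul hpos
  rw [div_pow, hprod, hsum]
  generalize ‖z - w‖ ^ 2 = A at *
  generalize ‖z - (starRingEnd ℂ) w‖ ^ 2 = B at *
  field_simp
  ring

lemma lintegral_omegaMeasure {F : ℝ × ℝ → ENNReal} (hF : Measurable F) :
    ∫⁻ p, F p ∂omegaMeasure =
      ∫⁻ a, ∫⁻ b, ENNReal.ofReal ((4 - twoCos a * twoCos b) / 4) * F (twoCos a, twoCos b)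
        ∂haarAddCircle ∂haarAddCircle := by
  have hc := continuous_twoCos.measurable
  rw [omegaMeasure_eq_withDensity_prod,
    lintegral_withDensity_eq_lintegral_mul _ (by fun_prop) hF, arcsineLaw_eq_map,
    Measure.map_prod_map _ _ hc hc, lintegral_map (by fun_prop) (by fun_prop),
    lintegral_prod _ (by fun_prop)]
  rfl

/-- The squared increment of `f ∘ twoCos` divided by the squared chord length on the circle. -/
noncomputable def chordalKernel (f : ℝ → ℝ) (a b : AddCircle (2 * π)) : ENNReal :=
  ENNReal.ofReal ((f (twoCos a) - f (twoCos b)) ^ 2 / ‖fourier 1 a - (fourier 1 b : ℂ)‖ ^ 2)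

lemma measurable_chordalKernel {f : ℝ → ℝ} (hf : Measurable f) :
    Measurable fun p : AddCircle (2 * π) × AddCircle (2 * π) => chordalKernel f p.1 p.2 := by
  have hc := continuous_twoCos.measurable
  have hfour : Measurable fun t : AddCircle (2 * π) => (fourier 1 t : ℂ) :=
    (fourier 1).continuous.measurable
  unfold chordalKernel
  exact ENNReal.measurable_ofReal.comp
    ((((hf.comp (hc.comp measurable_fst)).sub (hf.comp (hc.comp measurable_snd))).pow_const 2).div
      (((hfour.comp measurable_fst).sub (hfour.comp measurable_snd)).norm.pow_const 2))

lemma ofReal_mul_sq_slope_twoCos (f : ℝ → ℝ) (a b : AddCircle (2 * π)) :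
    ENNReal.ofReal ((4 - twoCos a * twoCos b) / 4) * ENNReal.ofReal
        (((f (twoCos a) - f (twoCos b)) / (twoCos a - twoCos b)) ^ 2) =
      ENNReal.ofReal (1 / 4) * chordalKernel f a b +
        ENNReal.ofReal (1 / 4) * chordalKernel f a (-b) := by
  have hneg : fourier 1 (-b) = (starRingEnd ℂ) (fourier 1 b) := by
    rw [← fourier_neg]; simp [fourier_apply]
  rw [← ENNReal.ofReal_mul' (by positivity), chordalKernel, chordalKernel, twoCos_neg, hneg,
    ← ENNReal.ofReal_mul (by norm_num), ← ENNReal.ofReal_mul (by norm_num),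
    ← ENNReal.ofReal_add (by positivity) (by positivity)]
  congr 1
  exact four_sub_mul_div_sq_mul (by rw [fourier_one, Circle.norm_coe])
    (by rw [fourier_one, Circle.norm_coe]) f

lemma chordalKernel_add_left (f : ℝ → ℝ) (t b : AddCircle (2 * π)) :
    chordalKernel f (t + b) b =
      ENNReal.ofReal ((f (twoCos (t + b)) - f (twoCos b)) ^ 2 / ‖fourier 1 t - 1‖ ^ 2) := by
  have : fourier 1 (t + b) - (fourier 1 b : ℂ) = (fourier 1 t - 1) * fourier 1 b := by
    simp only [fourier_one, toCircle_add, Circle.coe_mul]; ring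
  rw [chordalKernel, this, norm_mul, fourier_one (x := b), Circle.norm_coe, mul_one]

/-- The energy with respect to `ω` is half the chordal energy on the circle. -/
lemma lintegral_sq_slope_omegaMeasure {f : ℝ → ℝ} (hf : Measurable f) :
    ∫⁻ p, ENNReal.ofReal (((f p.1 - f p.2) / (p.1 - p.2)) ^ 2) ∂omegaMeasure =
      ENNReal.ofReal (1 / 2) * ∫⁻ t, ∫⁻ b,
        ENNReal.ofReal ((f (twoCos (t + b)) - f (twoCos b)) ^ 2 / ‖fourier 1 t - 1‖ ^ 2)
        ∂haarAddCircle ∂haarAddCircle := by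
  have hKm := measurable_chordalKernel hf
  have hKb : ∀ a, Measurable (chordalKernel f a) := fun a =>
    Measurable.of_uncurry_left (f := chordalKernel f) hKm
  have hinner : ∀ a, ∫⁻ b, (ENNReal.ofReal (1 / 4) * chordalKernel f a b +
      ENNReal.ofReal (1 / 4) * chordalKernel f a (-b)) ∂haarAddCircle =
      ENNReal.ofReal (1 / 2) * ∫⁻ b, chordalKernel f a b ∂haarAddCircle := fun a => by
    have hKn : Measurable fun b => chordalKernel f a (-b) := (hKb a).comp measurable_neg
    rw [lintegral_add_left ((hKb a).const_mul _), lintegral_const_mul _ (hKb a),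
      lintegral_const_mul _ hKn,
      lintegral_neg_eq_self (chordalKernel f a), ← add_mul,
      ← ENNReal.ofReal_add (by norm_num) (by norm_num)]
    norm_num
  have hshift : ∫⁻ a, ∫⁻ b, chordalKernel f a b ∂haarAddCircle ∂haarAddCircle =
      ∫⁻ t, ∫⁻ b, chordalKernel f (t + b) b ∂haarAddCircle ∂haarAddCircle := by
    rw [lintegral_lintegral_swap hKm.aemeasurable,
      lintegral_lintegral_swap (f := fun t b => chordalKernel f (t + b) b)
        (hKm.comp ((measurable_fst.add measurable_snd).prodMk measurable_snd)).aemeasurable]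
    exact lintegral_congr fun b =>
      (lintegral_add_right_eq_self (fun a => chordalKernel f a b) b).symm
  rw [lintegral_omegaMeasure (F := fun p => ENNReal.ofReal (((f p.1 - f p.2) / (p.1 - p.2)) ^ 2))
    (by fun_prop)]
  calc _ = ∫⁻ a, ENNReal.ofReal (1 / 2) * ∫⁻ b, chordalKernel f a b ∂haarAddCircle
        ∂haarAddCircle := lintegral_congr fun a =>
          (lintegral_congr fun b => ofReal_mul_sq_slope_twoCos f a b).trans (hinner a)
    _ = ENNReal.ofReal (1 / 2) * ∫⁻ t, ∫⁻ b, chordalKernel f (t + b) b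
        ∂haarAddCircle ∂haarAddCircle := by
      rw [lintegral_const_mul _ hKm.lintegral_prod_right', hshift]
    _ = _ := congrArg _ (lintegral_congr fun t => lintegral_congr fun b =>
        chordalKernel_add_left f t b)

lemma lintegral_sq_slope_omegaMeasure_ne_top {f : ℝ → ℝ} (hf : ContDiff ℝ 1 f) :
    ∫⁻ p, ENNReal.ofReal (((f p.1 - f p.2) / (p.1 - p.2)) ^ 2) ∂omegaMeasure ≠ ⊤ := by
  have hfm := hf.continuous.measurable
  obtain ⟨L, hL⟩ := hf.contDiffOn.exists_lipschitzOnWith one_ne_zero (convex_Icc (-2 : ℝ) 2)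
    isCompact_Icc
  rw [lintegral_omegaMeasure (by fun_prop)]
  refine ne_top_of_le_ne_top (b := ENNReal.ofReal (2 * L ^ 2)) ENNReal.ofReal_ne_top ?_
  calc _ ≤ ∫⁻ a, ∫⁻ b, ENNReal.ofReal (2 * L ^ 2) ∂(haarAddCircle (T := 2 * π))
        ∂(haarAddCircle (T := 2 * π)) := lintegral_mono fun a => lintegral_mono fun b => ?_
    _ = _ := by simp
  have ha := abs_le.1 (abs_twoCos_le a)
  have hb := abs_le.1 (abs_twoCos_le b)
  rw [← ENNReal.ofReal_mul' (by positivity)]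
  refine ENNReal.ofReal_le_ofReal (mul_le_mul (by nlinarith) ?_ (by positivity) (by norm_num))
  have h := hL.dist_le_mul _ ha _ hb
  rw [Real.dist_eq, Real.dist_eq] at h
  rw [← sq_abs, abs_div]
  exact pow_le_pow_left₀ (by positivity) (div_le_of_le_mul₀ (abs_nonneg _) L.2 h) 2

/-- The spectral-gap (Poincaré) inequality for the arcsine law:
`(1/2) Var_β(f) ≤ ∬ ((f(x)-f(y))/(x-y))² ω(dx dy)` for `C¹` functions `f`. -/
theorem arcsine_spectral_gap (f : ℝ → ℝ) (hf : ContDiff ℝ 1 f) :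
    (1 / 2) * ((∫ x, f x ^ 2 ∂arcsineLaw) - (∫ x, f x ∂arcsineLaw) ^ 2) ≤
      ∫ p : ℝ × ℝ, ((f p.1 - f p.2) / (p.1 - p.2)) ^ 2 ∂omegaMeasure := by
  set G : C(AddCircle (2 * π), ℂ) :=
    ⟨fun t => (f (twoCos t) : ℂ), Complex.continuous_ofReal.comp
      (hf.continuous.comp continuous_twoCos)⟩
  have hc := continuous_twoCos.measurable.aemeasurable (μ := haarAddCircle)
  have hfc := hf.continuous
  have hfm := hfc.measurable
  have h1 : ∫ t, ‖G t‖ ^ 2 ∂haarAddCircle = ∫ x, f x ^ 2 ∂arcsineLaw := by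
    rw [arcsineLaw_eq_map, integral_map hc (by fun_prop)]
    simp [G]
  have h2 : ‖∫ t, G t ∂haarAddCircle‖ ^ 2 = (∫ x, f x ∂arcsineLaw) ^ 2 := by
    rw [arcsineLaw_eq_map, integral_map hc (by fun_prop)]
    simp only [G, ContinuousMap.coe_mk]
    rw [integral_complex_ofReal, Complex.norm_real, Real.norm_eq_abs, sq_abs]
  have h3 := ofReal_variance_le_lintegral_translate_sub G
  rw [h1, h2] at h3
  rw [integral_eq_lintegral_of_nonneg_ae (μ := omegaMeasure)
      (Filter.Eventually.of_forall fun p => sq_nonneg _)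
      (Measurable.aestronglyMeasurable (by fun_prop)),
    ← ENNReal.ofReal_le_iff_le_toReal (lintegral_sq_slope_omegaMeasure_ne_top hf),
    lintegral_sq_slope_omegaMeasure hfm, ENNReal.ofReal_mul (by norm_num)]
  gcongr
  refine h3.trans_eq (lintegral_congr fun t => lintegral_congr fun b => ?_)
  simp only [G, ContinuousMap.coe_mk]
  rw [← Complex.ofReal_sub, Complex.norm_real, Real.norm_eq_abs, sq_abs]
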